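/- arXiv:1503.02627 — 2 statements merged into one kernel-verified Lean document; each statement's English description precedes it below -/
import Mathlib

section
/- Let G be a finite group with identity e. Equip Option G with operations: (some g) ⋆ (some h) = some (g * h) and x ⋆ none = none ⋆ x = none; x ⊓ y = x if x = y and x ⊓ y = none otherwise; ad(none) = some e and ad(some g) = none; r(none) = none and r(some g) = some e. Then the map θ : Option G → Set (G × G) given by θ(none) = ∅ and θ(some g) = {(h, h * g) | h ∈ G} is a representation of (Option G, ⋆, ⊓, ad, r) by partial functions on G; in particular this algebra is representable by partial functions. -/
universe u v w

/-- A set of pairs is functional (is a partial function). -/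
def Functional {X : Type u} (f : Set (X × X)) : Prop :=
  ∀ x y y' : X, (x, y) ∈ f → (x, y') ∈ f → y = y'

/-- Composition of partial functions (left-to-right). -/
def pComp {X : Type u} (f g : Set (X × X)) : Set (X × X) :=
  {p | ∃ y, (p.1, y) ∈ f ∧ (y, p.2) ∈ g}

/-- Diagonal of the domain. -/
def pDom {X : Type u} (f : Set (X × X)) : Set (X × X) :=
  {p | p.1 = p.2 ∧ ∃ y, (p.1, y) ∈ f}

/-- Diagonal of the range. -/
def pRan {X : Type u} (f : Set (X × X)) : Set (X × X) :=
  {p | p.1 = p.2 ∧ ∃ x, (x, p.2) ∈ f}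

/-- The identity function on `X`. -/
def pId (X : Type u) : Set (X × X) := {p | p.1 = p.2}

/-- Diagonal of the antidomain. -/
def pAnti {X : Type u} (f : Set (X × X)) : Set (X × X) :=
  {p | p.1 = p.2 ∧ ¬∃ y, (p.1, y) ∈ f}

/-- Fixset: diagonal of the fixed points. -/
def pFix {X : Type u} (f : Set (X × X)) : Set (X × X) :=
  {p | p.1 = p.2 ∧ (p.1, p.1) ∈ f}

/-- Preferential union. -/
def pPref {X : Type u} (f g : Set (X × X)) : Set (X × X) :=
  f ∪ {p | p ∈ g ∧ ¬∃ z, (p.1, z) ∈ f}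

/-- Iterated composition: `pPow f 0 = pId X`, `pPow f (n+1) = f ∘ pPow f n`. -/
def pPow {X : Type u} (f : Set (X × X)) : ℕ → Set (X × X)
  | 0 => pId X
  | n + 1 => pComp f (pPow f n)

/-- Maximum iterate. -/
def pMaxIter {X : Type u} (f : Set (X × X)) : Set (X × X) :=
  ⋃ n : ℕ, pComp (pPow f n) (pAnti f)

/-- Opposite (bilateral inverse). -/
def pOpp {X : Type u} (f : Set (X × X)) : Set (X × X) :=
  {p | (p.2, p.1) ∈ f ∧ ∀ x', (x', p.1) ∈ f → x' = p.2}

/-- Unique-preimage operation. -/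
def pU {X : Type u} (f : Set (X × X)) : Set (X × X) :=
  {p | p.1 = p.2 ∧ ∃! x, (x, p.2) ∈ f}

/-- The future of a vertex `x` with respect to `θ`. -/
def future {A : Type*} {X : Type u} (θ : A → Set (X × X)) (x : X) : Set X :=
  {y | ∃ b : A, (x, y) ∈ θ b}

/-- The present of a vertex `x` with respect to `θ`. -/
def present {A : Type*} {X : Type u} (θ : A → Set (X × X)) (x : X) : Set X :=
  {y | y ∈ future θ x ∧ x ∈ future θ y}

/-- `a` labels the edge `(x, y)`: `a` holds there and is least among elements holding there. -/
def Labels {A : Type*} {X : Type u} (meet : A → A → A) (θ : A → Set (X × X))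
    (a : A) (x y : X) : Prop :=
  (x, y) ∈ θ a ∧ ∀ b : A, (x, y) ∈ θ b → meet a b = a

/-- Representation for the signature {composition, intersection, antidomain, range}. -/
def IsRepAd {A : Type*} {X : Type u} (star meet : A → A → A) (ad r : A → A)
    (θ : A → Set (X × X)) : Prop :=
  Function.Injective θ ∧ (∀ a, Functional (θ a)) ∧
  (∀ a b, θ (star a b) = pComp (θ a) (θ b)) ∧
  (∀ a b, θ (meet a b) = θ a ∩ θ b) ∧
  (∀ a, θ (ad a) = pAnti (θ a)) ∧
  (∀ a, θ (r a) = pRan (θ a))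

/-- A finite group with a zero adjoined is representable by partial functions in the
antidomain signature, via (an augmentation of) the Cayley representation. -/
theorem group_with_zero_representable (G : Type u) [Group G] [Fintype G] [DecidableEq G] :
    IsRepAd
      (fun x y : Option G => x.bind fun g => y.map fun h => g * h)
      (fun x y : Option G => if x = y then x else none)
      (fun x : Option G => x.elim (some (1 : G)) fun _ => none)
      (fun x : Option G => x.map fun _ => (1 : G))
      (fun x : Option G => x.elim (∅ : Set (G × G)) fun g => {p : G × G | p.2 = p.1 * g}) := by
  refine ⟨?_, ?_, ?_, ?_, ?_, ?_⟩
  · rintro (_ | g) (_ | h) H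
    · rfl
    · have := (Set.ext_iff.1 H (1, h)).2 (by simp)
      simp at this
    · have := (Set.ext_iff.1 H (1, g)).1 (by simp)
      simp at this
    · have := (Set.ext_iff.1 H (1, g)).1 (by simp)
      simpa using this
  · rintro (_ | g) x y y' hy hy'
    · simp at hy
    · exact Eq.trans hy (Eq.symm hy')
  · rintro (_ | g) (_ | h) <;> ext ⟨x, y⟩ <;> simp [pComp, mul_assoc]
  · rintro (_ | g) (_ | h)
    · simp
    · simp
    · simp
    · by_cases hgh : g = h
      · simp [hgh]
      · ext ⟨x, y⟩
        simp only [Option.some.injEq, hgh, if_false, Option.elim_none, Option.elim_some,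
          Set.mem_empty_iff_false, Set.mem_inter_iff, Set.mem_ofPred_eq, false_iff]
        rintro ⟨hg, hh⟩
        exact hgh (mul_left_cancel (hg.symm.trans hh))
  · rintro (_ | g) <;> ext ⟨x, y⟩ <;> simp [pAnti, eq_comm]
  · rintro (_ | g) <;> ext ⟨x, y⟩
    · simp [pRan]
    · have : ∃ z, y = z * g := ⟨y * g⁻¹, by simp⟩
      simp [pRan, this, eq_comm]
end

section
/- (Failure of the finite representation property.) There exist a finite type A equipped with binary operations ⋆, ⊓ and unary operations d, r, u, and a representation of (A, ⋆, ⊓, d, r, u) by partial functions on some type X (for the signature {composition, intersection, domain, range, U}), such that there is no representation of (A, ⋆, ⊓, d, r, u) by partial functions on any finite type. -/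
universe u v w

/-- Representation for the signature {composition, intersection, domain, range, U}. -/
def IsRepU {A : Type*} {X : Type u} (star meet : A → A → A) (d r u : A → A)
    (θ : A → Set (X × X)) : Prop :=
  Function.Injective θ ∧ (∀ a, Functional (θ a)) ∧
  (∀ a b, θ (star a b) = pComp (θ a) (θ b)) ∧
  (∀ a b, θ (meet a b) = θ a ∩ θ b) ∧
  (∀ a, θ (d a) = pDom (θ a)) ∧
  (∀ a, θ (r a) = pRan (θ a)) ∧
  (∀ a, θ (u a) = pU (θ a))

/-- On a finite type, if some partial function with the same domain and range as `g` is injective,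
then so is `g`. -/
theorem pU_eq_pRan_of_finite {Y : Type u} [Finite Y] {f g : Set (Y × Y)}
    (hf : Functional f) (hg : Functional g) (hdom : pDom f = pDom g) (hran : pRan f = pRan g)
    (hU : pU f = pRan f) : pU g = pRan g := by
  have hdom' : ∀ x, (∃ y, (x, y) ∈ f) ↔ ∃ y, (x, y) ∈ g := fun x => by
    simpa [pDom] using Set.ext_iff.1 hdom (x, x)
  have hran' : ∀ y, (∃ x, (x, y) ∈ f) ↔ ∃ x, (x, y) ∈ g := fun y => by
    simpa [pRan] using Set.ext_iff.1 hran (y, y)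
  have hU' : ∀ y, (∃! x, (x, y) ∈ f) ↔ ∃ x, (x, y) ∈ f := fun y => by
    simpa [pU, pRan] using Set.ext_iff.1 hU (y, y)
  let E := {x // ∃ y, (x, y) ∈ g}
  let F := {y // ∃ x, (x, y) ∈ g}
  choose φ hφ using fun x : E => (hdom' x).2 x.2
  choose γ hγ using fun x : E => x.2
  let φ' : E → F := fun x => ⟨φ x, (hran' _).1 ⟨x, hφ x⟩⟩
  let γ' : E → F := fun x => ⟨γ x, x, hγ x⟩
  have hφ' : Function.Bijective φ' := by
    constructor
    · intro x x' h
      have h' : φ x = φ x' := congrArg Subtype.val h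
      exact Subtype.ext (((hU' _).2 ⟨x, hφ x⟩).unique (hφ x) (h' ▸ hφ x'))
    · rintro ⟨y, hy⟩
      obtain ⟨x, hx⟩ := (hran' y).2 hy
      exact ⟨⟨x, (hdom' x).1 ⟨y, hx⟩⟩, Subtype.ext (hf _ _ _ (hφ _) hx)⟩
  have hγ' : Function.Surjective γ' := by
    rintro ⟨y, x, hx⟩
    exact ⟨⟨x, y, hx⟩, Subtype.ext (hg _ _ _ (hγ _) hx)⟩
  have hinj : Function.Injective γ' := hγ'.injective_of_finite (Equiv.ofBijective φ' hφ')
  ext ⟨y, y'⟩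
  refine and_congr_right fun _ => ⟨ExistsUnique.exists, ?_⟩
  rintro ⟨x, hx⟩
  refine ⟨x, hx, fun x' hx' => ?_⟩
  have h : γ' ⟨x', y', hx'⟩ = γ' ⟨x, y', hx⟩ :=
    Subtype.ext ((hg _ _ _ (hγ _) hx').trans (hg _ _ _ (hγ _) hx).symm)
  exact congrArg Subtype.val (hinj h)

/-- The algebra generated by a bijection `inj` and a disjoint two-to-one surjection `dbl` between
the same two disjoint sets, whose identity functions are `dom` and `ran`. -/
inductive DoublingAlg
  | zero | dom | ran | inj | dbl
  deriving DecidableEq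

namespace DoublingAlg

instance : Fintype DoublingAlg where
  elems := {zero, dom, ran, inj, dbl}
  complete a := by cases a <;> decide

/-- Composition in `DoublingAlg`. -/
def star : DoublingAlg → DoublingAlg → DoublingAlg
  | dom, dom => dom
  | dom, inj => inj
  | dom, dbl => dbl
  | ran, ran => ran
  | inj, ran => inj
  | dbl, ran => dbl
  | _, _ => zero

/-- Intersection in `DoublingAlg`. -/
def meet (a b : DoublingAlg) : DoublingAlg := if a = b then a else zero

/-- Domain in `DoublingAlg`. -/
def domain : DoublingAlg → DoublingAlg
  | zero => zero
  | ran => ran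
  | _ => dom

/-- Range in `DoublingAlg`. -/
def range : DoublingAlg → DoublingAlg
  | zero => zero
  | dom => dom
  | _ => ran

/-- The unique-preimage operation in `DoublingAlg`. -/
def uniq : DoublingAlg → DoublingAlg
  | zero => zero
  | dom => dom
  | dbl => zero
  | _ => ran

/-- A representation of `DoublingAlg` on two copies of `ℤ`. The map `n ↦ 2 - n / 2` is two-to-one
and has no fixed points. -/
def rep : DoublingAlg → Set ((Bool × ℤ) × (Bool × ℤ))
  | zero => ∅
  | dom => {p | p.1.1 = false ∧ p.2.1 = false ∧ p.2.2 = p.1.2}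
  | ran => {p | p.1.1 = true ∧ p.2.1 = true ∧ p.2.2 = p.1.2}
  | inj => {p | p.1.1 = false ∧ p.2.1 = true ∧ p.2.2 = p.1.2}
  | dbl => {p | p.1.1 = false ∧ p.2.1 = true ∧ p.2.2 = 2 - p.1.2 / 2}

theorem rep_injective : Function.Injective rep := by
  intro a b h
  have h₀ := Set.ext_iff.1 h ((false, 0), (false, 0))
  have h₁ := Set.ext_iff.1 h ((true, 0), (true, 0))
  have h₂ := Set.ext_iff.1 h ((false, 0), (true, 0))
  have h₃ := Set.ext_iff.1 h ((false, 0), (true, 2))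
  clear h
  cases a <;> cases b <;> simp_all [rep]

theorem functional_rep (a : DoublingAlg) : Functional (rep a) := by
  rintro ⟨i, m⟩ ⟨j, n⟩ ⟨k, l⟩ h h'
  cases a <;> simp_all [rep]

theorem rep_star (a b : DoublingAlg) : rep (star a b) = pComp (rep a) (rep b) := by
  ext ⟨⟨i, m⟩, ⟨j, n⟩⟩
  cases a <;> cases b <;> simp [rep, star, pComp]

theorem rep_meet (a b : DoublingAlg) : rep (meet a b) = rep a ∩ rep b := by
  ext ⟨⟨i, m⟩, ⟨j, n⟩⟩
  cases a <;> cases b <;> simp [rep, meet] <;> grind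

theorem rep_domain (a : DoublingAlg) : rep (domain a) = pDom (rep a) := by
  ext ⟨⟨i, m⟩, ⟨j, n⟩⟩
  cases a <;> simp [rep, domain, pDom] <;> grind

theorem exists_two_sub_half_eq (n : ℤ) : ∃ m : ℤ, n = 2 - m / 2 := ⟨4 - 2 * n, by omega⟩

theorem rep_range (a : DoublingAlg) : rep (range a) = pRan (rep a) := by
  ext ⟨⟨i, m⟩, ⟨j, n⟩⟩
  have := exists_two_sub_half_eq n
  cases a <;> simp [rep, range, pRan] <;> grind

theorem rep_uniq (a : DoublingAlg) : rep (uniq a) = pU (rep a) := by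
  ext ⟨⟨i, m⟩, ⟨j, n⟩⟩
  cases a
  case dbl =>
    refine iff_of_false id ?_
    rintro ⟨-, ⟨k, l⟩, ⟨hk, hj, hn⟩, hu⟩
    have h₀ := hu (false, 4 - 2 * n) ⟨rfl, hj, by dsimp only; omega⟩
    have h₁ := hu (false, 5 - 2 * n) ⟨rfl, hj, by dsimp only; omega⟩
    simp only [Prod.mk.injEq] at h₀ h₁
    omega
  all_goals simp [rep, uniq, pU, ExistsUnique] <;> grind

theorem isRepU_rep : IsRepU star meet domain range uniq rep :=
  ⟨rep_injective, functional_rep, rep_star, rep_meet, rep_domain, rep_range, rep_uniq⟩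

theorem not_isRepU_of_finite {Y : Type u} [Finite Y] (θ : DoublingAlg → Set (Y × Y)) :
    ¬IsRepU star meet domain range uniq θ := by
  rintro ⟨hinj, hfun, -, -, hd, hr, hu⟩
  have h : pU (θ dbl) = pRan (θ dbl) :=
    pU_eq_pRan_of_finite (hfun inj) (hfun dbl) ((hd inj).symm.trans (hd dbl))
      ((hr inj).symm.trans (hr dbl)) ((hu inj).symm.trans (hr inj))
  have h' : zero = ran := hinj ((hu dbl).trans (h.trans (hr dbl).symm))
  cases h'

end DoublingAlg

/-- Failure of the finite representation property for the signature
{composition, intersection, domain, range, U}. -/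
theorem frp_fails_for_U :
    ∃ (A : Type) (_ : Fintype A) (star meet : A → A → A) (d r u : A → A),
      (∃ (X : Type) (θ : A → Set (X × X)), IsRepU star meet d r u θ) ∧
      ¬∃ (Y : Type) (_ : Fintype Y) (θ : A → Set (Y × Y)), IsRepU star meet d r u θ :=
  ⟨DoublingAlg, inferInstance, DoublingAlg.star, DoublingAlg.meet, DoublingAlg.domain,
    DoublingAlg.range, DoublingAlg.uniq, ⟨_, _, DoublingAlg.isRepU_rep⟩,
    fun ⟨_, _, θ, hθ⟩ => DoublingAlg.not_isRepU_of_finite θ hθ⟩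
end
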